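/- arXiv:1806.05393 — 9 statements merged into one kernel-verified Lean document; each statement's English description precedes it below -/
import Mathlib

section
/- Let n be a positive integer, ker = {β ∈ ℤ : |β| ≤ k}, v = (v_β)_{β∈ker} real numbers, and define the cross-correlation operator A_v on n×n real matrices by [A_v ⋆ C]_{α,α'} = Σ_{β∈ker} v_β C_{α+β, α'+β}, indices mod n. Fix γ ∈ ℝ. For α ≠ α' in ℤ/nℤ define M^{α,α'} by M^{α,α'}_{ᾱ,ᾱ'} = δ_{α,ᾱ}δ_{α',ᾱ'} + δ_{α,ᾱ'}δ_{α',ᾱ}, and for α ∈ ℤ/nℤ define M^{α,α} by M^{α,α}_{ᾱ,ᾱ'} = γ δ_{α,ᾱ}δ_{α,ᾱ'} + δ_{ᾱ,α} + δ_{ᾱ',α}. Then A_v ⋆ M^{α,α'} = Σ_{β∈ker} v_β M^{α−β, α'−β} (indices mod n) for every pair (α,α'), including diagonal pairs. Consequently, the subspaces V_d = span{M^{α,α} : α ∈ ℤ/nℤ} and V_od = span{M^{α,α'} : α ≠ α'} are each invariant under A_v ⋆. -/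
/-- The circular cross-correlation operator `[A_v ⋆ C]_{α,α'} = ∑_β v_β C_{α+β,α'+β}`. -/
noncomputable def aveOp (n k : ℕ) (v : ℤ → ℝ) (C : Matrix (ZMod n) (ZMod n) ℝ) :
    Matrix (ZMod n) (ZMod n) ℝ :=
  Matrix.of fun α α' =>
    ∑ β ∈ Finset.Icc (-(k : ℤ)) (k : ℤ), v β * C (α + (β : ZMod n)) (α' + (β : ZMod n))

/-- Off-diagonal basis matrix `M^{α,α'}_{ᾱ,ᾱ'} = δ_{α,ᾱ}δ_{α',ᾱ'} + δ_{α,ᾱ'}δ_{α',ᾱ}`. -/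
noncomputable def Mo (n : ℕ) (α α' : ZMod n) : Matrix (ZMod n) (ZMod n) ℝ :=
  Matrix.of fun a b =>
    (if α = a then (1 : ℝ) else 0) * (if α' = b then 1 else 0) +
      (if α = b then (1 : ℝ) else 0) * (if α' = a then 1 else 0)

/-- Diagonal basis matrix `M^{α,α}_{ᾱ,ᾱ'} = γ δ_{α,ᾱ}δ_{α,ᾱ'} + δ_{ᾱ,α} + δ_{ᾱ',α}`. -/
noncomputable def Md (n : ℕ) (γ : ℝ) (α : ZMod n) : Matrix (ZMod n) (ZMod n) ℝ :=
  Matrix.of fun a b =>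
    γ * (if α = a then (1 : ℝ) else 0) * (if α = b then 1 else 0) +
      (if a = α then (1 : ℝ) else 0) + (if b = α then 1 else 0)

theorem aveOp_Mo (n k : ℕ) (v : ℤ → ℝ) (α α' : ZMod n) :
    aveOp n k v (Mo n α α') =
      ∑ β ∈ Finset.Icc (-(k : ℤ)) (k : ℤ),
        v β • Mo n (α - (β : ZMod n)) (α' - (β : ZMod n)) := by
  ext a b
  simp only [aveOp, Mo, Matrix.of_apply, Matrix.sum_apply, Matrix.smul_apply, smul_eq_mul,
    sub_eq_iff_eq_add]

theorem aveOp_Md (n k : ℕ) (v : ℤ → ℝ) (γ : ℝ) (α : ZMod n) :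
    aveOp n k v (Md n γ α) =
      ∑ β ∈ Finset.Icc (-(k : ℤ)) (k : ℤ), v β • Md n γ (α - (β : ZMod n)) := by
  ext a b
  simp only [aveOp, Md, Matrix.of_apply, Matrix.sum_apply, Matrix.smul_apply, smul_eq_mul,
    sub_eq_iff_eq_add, eq_sub_iff_add_eq]

theorem aveOp_span (n k : ℕ) (v : ℤ → ℝ) (S : Set (Matrix (ZMod n) (ZMod n) ℝ))
    (hS : ∀ M ∈ S, aveOp n k v M ∈ Submodule.span ℝ S) :
    ∀ U ∈ Submodule.span ℝ S, aveOp n k v U ∈ Submodule.span ℝ S := by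
  intro U hU
  induction hU using Submodule.span_induction with
  | mem x hx => exact hS x hx
  | zero =>
    have h : aveOp n k v 0 = 0 := by
      ext a b
      simp [aveOp]
    rw [h]
    exact Submodule.zero_mem _
  | add x y _ _ hx hy =>
    have h : aveOp n k v (x + y) = aveOp n k v x + aveOp n k v y := by
      ext a b
      simp [aveOp, mul_add, Finset.sum_add_distrib]
    rw [h]
    exact Submodule.add_mem _ hx hy
  | smul c x _ hx =>
    have h : aveOp n k v (c • x) = c • aveOp n k v x := by
      ext a b
      simp [aveOp, Finset.mul_sum, mul_left_comm]
    rw [h]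
    exact Submodule.smul_mem _ c hx

/-- The averaging operator `A_v ⋆` acts on the basis matrices `M^{α,α'}` by
`A_v ⋆ M^{α,α'} = ∑_β v_β M^{α−β,α'−β}` (including diagonal pairs); consequently the
diagonal span `V_d` and the off-diagonal span `V_od` are invariant under `A_v ⋆`. -/
theorem stmt3
    (n k : ℕ) (hn : 0 < n) (v : ℤ → ℝ) (γ : ℝ) :
    (∀ α α' : ZMod n, α ≠ α' →
      aveOp n k v (Mo n α α') =
        ∑ β ∈ Finset.Icc (-(k : ℤ)) (k : ℤ),
          v β • Mo n (α - (β : ZMod n)) (α' - (β : ZMod n))) ∧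
    (∀ α : ZMod n,
      aveOp n k v (Md n γ α) =
        ∑ β ∈ Finset.Icc (-(k : ℤ)) (k : ℤ), v β • Md n γ (α - (β : ZMod n))) ∧
    (∀ U ∈ Submodule.span ℝ (Set.range (Md n γ)),
      aveOp n k v U ∈ Submodule.span ℝ (Set.range (Md n γ))) ∧
    (∀ U ∈ Submodule.span ℝ
        {M : Matrix (ZMod n) (ZMod n) ℝ | ∃ α α' : ZMod n, α ≠ α' ∧ M = Mo n α α'},
      aveOp n k v U ∈ Submodule.span ℝ
        {M : Matrix (ZMod n) (ZMod n) ℝ | ∃ α α' : ZMod n, α ≠ α' ∧ M = Mo n α α'}) := by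
  refine ⟨fun α α' _ => aveOp_Mo n k v α α', aveOp_Md n k v γ,
    aveOp_span n k v _ ?_, aveOp_span n k v _ ?_⟩
  · rintro _ ⟨α, rfl⟩
    rw [aveOp_Md]
    exact Submodule.sum_mem _ fun β _ =>
      Submodule.smul_mem _ _ (Submodule.subset_span ⟨_, rfl⟩)
  · rintro _ ⟨α, α', hne, rfl⟩
    rw [aveOp_Mo]
    exact Submodule.sum_mem _ fun β _ =>
      Submodule.smul_mem _ _ (Submodule.subset_span
        ⟨_, _, fun h => hne (sub_left_injective h), rfl⟩)
end

section
/- Let φ : ℝ → ℝ be twice continuously differentiable with φ, φ', φ'' all of at most polynomial growth (there exist constants C, m such that |φ(t)| + |φ'(t)| + |φ''(t)| ≤ C(1+|t|)^m for all t). Fix q > 0 and let u₁, u₂ be independent standard Gaussian random variables. Define f : (−1,1) → ℝ by f(c) = E[ φ(√q u₁) · φ(√q (c u₁ + √(1−c²) u₂)) ]. Then f is differentiable on (−1,1) and f'(c) = q · E[ φ'(√q u₁) · φ'(√q (c u₁ + √(1−c²) u₂)) ]. -/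
open MeasureTheory ProbabilityTheory

lemma aux_int1 (k : ℕ) : Integrable (fun x : ℝ => (1 + |x|) ^ k) (gaussianReal 0 1) := by
  have h : MemLp (fun x : ℝ => 1 + |x|) (k : ENNReal) (gaussianReal 0 1) := by
    have h1 : MemLp (id : ℝ → ℝ) (k : ENNReal) (gaussianReal 0 1) :=
      memLp_id_gaussianReal' _ (by simp)
    exact (memLp_const (1 : ℝ)).add h1.norm
  have h2 := h.integrable_norm_pow'
  refine h2.congr (Filter.Eventually.of_forall fun x => ?_)
  simp only [Real.norm_eq_abs]
  rw [abs_of_nonneg (by positivity)]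

/-- polynomial weight -/
noncomputable def auxP (u : ℝ × ℝ) : ℝ := (1 + |u.1|) * (1 + |u.2|)

lemma one_le_auxP (u : ℝ × ℝ) : 1 ≤ auxP u := by
  unfold auxP
  nlinarith [abs_nonneg u.1, abs_nonneg u.2, mul_nonneg (abs_nonneg u.1) (abs_nonneg u.2)]

lemma aux_int2 (k : ℕ) : Integrable (fun u : ℝ × ℝ => auxP u ^ k)
    ((gaussianReal 0 1).prod (gaussianReal 0 1)) := by
  refine ((aux_int1 k).mul_prod (aux_int1 k)).congr (Filter.Eventually.of_forall fun u => ?_)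
  simp [auxP, mul_pow]

lemma aux_int3 (K : ℝ) (k : ℕ) (g : ℝ × ℝ → ℝ) (hg : Continuous g)
    (hb : ∀ u, |g u| ≤ K * auxP u ^ k) :
    Integrable g ((gaussianReal 0 1).prod (gaussianReal 0 1)) := by
  refine ((aux_int2 k).const_mul K).mono' hg.aestronglyMeasurable
    (Filter.Eventually.of_forall fun u => ?_)
  simpa using hb u

lemma aux_density (g : ℝ → ℝ) (h : Integrable g (gaussianReal 0 1)) :
    Integrable (fun x => gaussianPDFReal 0 1 x * g x) := by
  rw [gaussianReal_of_var_ne_zero 0 one_ne_zero,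
    integrable_withDensity_iff_integrable_smul' (measurable_gaussianPDF _ _)
      (Filter.Eventually.of_forall fun x => gaussianPDF_lt_top)] at h
  simpa using h

lemma aux_deriv_pdf (x : ℝ) :
    HasDerivAt (gaussianPDFReal 0 1) (-x * gaussianPDFReal 0 1 x) x := by
  rw [gaussianPDFReal_def]
  have h1 : HasDerivAt (fun x : ℝ => -(x - 0) ^ 2 / (2 * ((1 : NNReal) : ℝ))) (-x) x := by
    have := ((((hasDerivAt_id x).sub_const 0).pow 2).neg).div_const (2 * ((1 : NNReal) : ℝ))
    convert! this using 1
    simp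
    ring
  have := (h1.exp).const_mul ((√(2 * Real.pi * ((1 : NNReal) : ℝ)))⁻¹)
  convert! this using 1
  ring

lemma aux_stein (g g' : ℝ → ℝ) (hd : ∀ x, HasDerivAt g (g' x) x)
    (h0 : Integrable g (gaussianReal 0 1)) (h1 : Integrable (fun x => x * g x) (gaussianReal 0 1))
    (h2 : Integrable g' (gaussianReal 0 1)) :
    ∫ x, x * g x ∂(gaussianReal 0 1) = ∫ x, g' x ∂(gaussianReal 0 1) := by
  rw [integral_gaussianReal_eq_integral_smul one_ne_zero,
    integral_gaussianReal_eq_integral_smul one_ne_zero]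
  have := integral_mul_deriv_eq_deriv_mul_of_integrable (u := g) (u' := g')
    (v := gaussianPDFReal 0 1) (v' := fun x => -x * gaussianPDFReal 0 1 x)
    (fun x _ => hd x) (fun x _ => aux_deriv_pdf x)
    ((aux_density _ h1).neg.congr (Filter.Eventually.of_forall fun x => by
      simp only [Pi.neg_apply, Pi.mul_apply]; ring))
    ((aux_density _ h2).congr (Filter.Eventually.of_forall fun x => by
      simp only [Pi.mul_apply]; ring))
    ((aux_density _ h0).congr (Filter.Eventually.of_forall fun x => by
      simp only [Pi.mul_apply]; ring))
  calc ∫ x, gaussianPDFReal 0 1 x • (x * g x)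
      = -∫ x, g x * (-x * gaussianPDFReal 0 1 x) := by
        rw [← integral_neg]; congr 1; ext x; simp only [smul_eq_mul]; ring
    _ = ∫ x, gaussianPDFReal 0 1 x • g' x := by
        rw [this, neg_neg]; congr 1; ext x; simp only [smul_eq_mul]; ring

lemma aux_stein_fst (g g' : ℝ × ℝ → ℝ) (hd : ∀ x y, HasDerivAt (fun t => g (t, y)) (g' (x, y)) x)
    (h0 : Integrable g ((gaussianReal 0 1).prod (gaussianReal 0 1)))
    (h1 : Integrable (fun u : ℝ × ℝ => u.1 * g u) ((gaussianReal 0 1).prod (gaussianReal 0 1)))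
    (h2 : Integrable g' ((gaussianReal 0 1).prod (gaussianReal 0 1))) :
    ∫ u : ℝ × ℝ, u.1 * g u ∂((gaussianReal 0 1).prod (gaussianReal 0 1))
      = ∫ u, g' u ∂((gaussianReal 0 1).prod (gaussianReal 0 1)) := by
  rw [integral_prod_symm _ h1, integral_prod_symm _ h2]
  refine integral_congr_ae ?_
  filter_upwards [h0.prod_left_ae, h1.prod_left_ae, h2.prod_left_ae] with y a0 a1 a2
  exact aux_stein (fun x => g (x, y)) (fun x => g' (x, y)) (fun x => hd x y) a0 a1 a2

lemma aux_stein_snd (g g' : ℝ × ℝ → ℝ) (hd : ∀ x y, HasDerivAt (fun t => g (x, t)) (g' (x, y)) y)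
    (h0 : Integrable g ((gaussianReal 0 1).prod (gaussianReal 0 1)))
    (h1 : Integrable (fun u : ℝ × ℝ => u.2 * g u) ((gaussianReal 0 1).prod (gaussianReal 0 1)))
    (h2 : Integrable g' ((gaussianReal 0 1).prod (gaussianReal 0 1))) :
    ∫ u : ℝ × ℝ, u.2 * g u ∂((gaussianReal 0 1).prod (gaussianReal 0 1))
      = ∫ u, g' u ∂((gaussianReal 0 1).prod (gaussianReal 0 1)) := by
  rw [integral_prod _ h1, integral_prod _ h2]
  refine integral_congr_ae ?_
  filter_upwards [h0.prod_right_ae, h1.prod_right_ae, h2.prod_right_ae] with x a0 a1 a2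
  exact aux_stein (fun y => g (x, y)) (fun y => g' (x, y)) (fun y => hd x y) a0 a1 a2

lemma aux_prod_bound (A B : ℝ → ℝ) (C : ℝ) (m : ℕ) (hC : 0 ≤ C)
    (hA : ∀ t, |A t| ≤ C * (1 + |t|) ^ m) (hB : ∀ t, |B t| ≤ C * (1 + |t|) ^ m)
    (s c r : ℝ) (hs : 0 ≤ s) (hc : |c| ≤ 1) (hr : |r| ≤ 1) (u : ℝ × ℝ) :
    |A (s * u.1) * B (s * (c * u.1 + r * u.2))|
      ≤ (C * (1 + s) ^ m) ^ 2 * auxP u ^ (2 * m) := by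
  have key : ∀ z, |z| ≤ |u.1| + |u.2| → 1 + |s * z| ≤ (1 + s) * auxP u := by
    intro z hz
    rw [abs_mul, abs_of_nonneg hs]
    have h1 : |z| ≤ auxP u := by
      refine hz.trans ?_
      unfold auxP
      nlinarith [mul_nonneg (abs_nonneg u.1) (abs_nonneg u.2)]
    nlinarith [one_le_auxP u, mul_le_mul_of_nonneg_left h1 hs]
  have k1 := key u.1 (by linarith [abs_nonneg u.2])
  have k2 := key (c * u.1 + r * u.2) (by
    refine (abs_add_le _ _).trans ?_
    rw [abs_mul, abs_mul]
    nlinarith [abs_nonneg u.1, abs_nonneg u.2])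
  have b1 : |A (s * u.1)| ≤ C * ((1 + s) * auxP u) ^ m := (hA _).trans (by gcongr)
  have b2 : |B (s * (c * u.1 + r * u.2))| ≤ C * ((1 + s) * auxP u) ^ m := (hB _).trans (by gcongr)
  rw [abs_mul]
  calc _ ≤ (C * ((1 + s) * auxP u) ^ m) * (C * ((1 + s) * auxP u) ^ m) :=
        mul_le_mul b1 b2 (abs_nonneg _) ((abs_nonneg _).trans b1)
    _ = _ := by rw [mul_pow, mul_comm 2 m, pow_mul (auxP u)]; ring

lemma aux_fst_le (u : ℝ × ℝ) : |u.1| ≤ auxP u := by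
  unfold auxP
  nlinarith [abs_nonneg u.1, abs_nonneg u.2, mul_nonneg (abs_nonneg u.1) (abs_nonneg u.2)]

lemma aux_snd_le (u : ℝ × ℝ) : |u.2| ≤ auxP u := by
  unfold auxP
  nlinarith [abs_nonneg u.1, abs_nonneg u.2, mul_nonneg (abs_nonneg u.1) (abs_nonneg u.2)]

lemma aux_sqrt_deriv (x : ℝ) (hx : 0 < 1 - x ^ 2) :
    HasDerivAt (fun c : ℝ => √(1 - c ^ 2)) (-(x / √(1 - x ^ 2))) x := by
  have h := (((hasDerivAt_id x).pow 2).const_sub 1).sqrt hx.ne'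
  convert! h using 1
  simp
  ring


/-- Gaussian integration by parts: for `φ` twice continuously differentiable with `φ`,
`φ'`, `φ''` of at most polynomial growth, `q > 0`, and independent standard Gaussians
`u₁, u₂`, the function `f(c) = E[φ(√q u₁) φ(√q (c u₁ + √(1−c²) u₂))]` is differentiable
on `(−1,1)` with `f'(c) = q E[φ'(√q u₁) φ'(√q (c u₁ + √(1−c²) u₂))]`. -/
theorem stmt6
    (φ : ℝ → ℝ) (hφ : ContDiff ℝ 2 φ)
    (hgrowth : ∃ (C : ℝ) (m : ℕ), ∀ t : ℝ,
      |φ t| + |deriv φ t| + |deriv (deriv φ) t| ≤ C * (1 + |t|) ^ m)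
    (q : ℝ) (hq : 0 < q)
    (c : ℝ) (hc : c ∈ Set.Ioo (-1 : ℝ) 1) :
    HasDerivAt
      (fun c' : ℝ =>
        ∫ u : ℝ × ℝ,
          φ (Real.sqrt q * u.1) *
            φ (Real.sqrt q * (c' * u.1 + Real.sqrt (1 - c' ^ 2) * u.2))
          ∂((gaussianReal 0 1).prod (gaussianReal 0 1)))
      (q * ∫ u : ℝ × ℝ,
          deriv φ (Real.sqrt q * u.1) *
            deriv φ (Real.sqrt q * (c * u.1 + Real.sqrt (1 - c ^ 2) * u.2))
          ∂((gaussianReal 0 1).prod (gaussianReal 0 1)))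
      c := by
  obtain ⟨C, m, hg⟩ := hgrowth
  have hC : 0 ≤ C := by
    have := hg 0
    simp at this
    exact le_trans (by positivity) this
  have hb0 : ∀ t, |φ t| ≤ C * (1 + |t|) ^ m := fun t => by
    linarith [hg t, abs_nonneg (deriv φ t), abs_nonneg (deriv (deriv φ) t)]
  have hb1 : ∀ t, |deriv φ t| ≤ C * (1 + |t|) ^ m := fun t => by
    linarith [hg t, abs_nonneg (φ t), abs_nonneg (deriv (deriv φ) t)]
  have hb2 : ∀ t, |deriv (deriv φ) t| ≤ C * (1 + |t|) ^ m := fun t => by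
    linarith [hg t, abs_nonneg (deriv φ t), abs_nonneg (φ t)]
  have hφ1 : ContDiff ℝ 1 (deriv φ) := by
    have : ContDiff ℝ (1 + 1) φ := by simpa [one_add_one_eq_two] using hφ
    exact (contDiff_succ_iff_deriv.1 this).2.2
  have c0 : Continuous φ := hφ.continuous
  have c1 : Continuous (deriv φ) := hφ1.continuous
  have c2 : Continuous (deriv (deriv φ)) := hφ1.continuous_deriv le_rfl
  have d0 : ∀ t, HasDerivAt φ (deriv φ t) t := fun t =>
    (hφ.differentiable (by norm_num)).differentiableAt.hasDerivAt
  have d1 : ∀ t, HasDerivAt (deriv φ) (deriv (deriv φ) t) t := fun t =>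
    (hφ1.differentiable (by norm_num)).differentiableAt.hasDerivAt
  set s := √q with hs_def
  have hs : 0 ≤ s := Real.sqrt_nonneg q
  have hss : s * s = q := Real.mul_self_sqrt hq.le
  have hr1 : ∀ x : ℝ, |√(1 - x ^ 2)| ≤ 1 := fun x => by
    rw [abs_of_nonneg (Real.sqrt_nonneg _), Real.sqrt_le_iff]
    refine ⟨zero_le_one, ?_⟩
    nlinarith [sq_nonneg x]
  have hcabs : |c| < 1 := abs_lt.2 hc
  obtain ⟨d, hcd, hd1⟩ := exists_between hcabs
  have hd0 : 0 ≤ d := (abs_nonneg c).trans hcd.le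
  have hrd : 0 < √(1 - d ^ 2) := Real.sqrt_pos.2 (by nlinarith)
  have hrc : 0 < 1 - c ^ 2 := by nlinarith [sq_abs c, abs_nonneg c]
  have hrc' : 0 < √(1 - c ^ 2) := Real.sqrt_pos.2 hrc
  set K := (C * (1 + s) ^ m) ^ 2 with hK
  have hK0 : 0 ≤ K := by positivity
  have main := hasDerivAt_integral_of_dominated_loc_of_deriv_le
    (μ := (gaussianReal 0 1).prod (gaussianReal 0 1))
    (F := fun (c' : ℝ) (u : ℝ × ℝ) => φ (s * u.1) * φ (s * (c' * u.1 + √(1 - c' ^ 2) * u.2)))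
    (F' := fun (c' : ℝ) (u : ℝ × ℝ) => φ (s * u.1) *
      (deriv φ (s * (c' * u.1 + √(1 - c' ^ 2) * u.2)) * (s * (u.1 + -(c' / √(1 - c' ^ 2)) * u.2))))
    (x₀ := c) (s := Set.Ioo (-d) d)
    (bound := fun u => (K * (s * (1 + 1 / √(1 - d ^ 2)))) * auxP u ^ (2 * m + 1))
    (Ioo_mem_nhds (by linarith [abs_lt.1 hcd]) (by linarith [abs_lt.1 hcd]))
    (Filter.Eventually.of_forall fun x => Continuous.aestronglyMeasurable (by fun_prop))
    (aux_int3 K (2 * m) _ (by fun_prop) (fun u =>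
      aux_prod_bound φ φ C m hC hb0 hb0 s c _ hs hcabs.le (hr1 c) u))
    (Continuous.aestronglyMeasurable (by fun_prop))
    (Filter.Eventually.of_forall fun u x hx => by
      have hxd : |x| < d := abs_lt.2 hx
      have b := aux_prod_bound φ (deriv φ) C m hC hb0 hb1 s x _ hs (hxd.le.trans hd1.le) (hr1 x) u
      have hle : √(1 - d ^ 2) ≤ √(1 - x ^ 2) := Real.sqrt_le_sqrt (by
        nlinarith [sq_abs x, abs_nonneg x])
      have hw : |s * (u.1 + -(x / √(1 - x ^ 2)) * u.2)|
          ≤ s * (1 + 1 / √(1 - d ^ 2)) * auxP u := by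
        rw [abs_mul, abs_of_nonneg hs, mul_assoc]
        refine mul_le_mul_of_nonneg_left ?_ hs
        refine (abs_add_le _ _).trans ?_
        rw [abs_mul, abs_neg, abs_div, abs_of_nonneg (Real.sqrt_nonneg (1 - x ^ 2)), add_mul,
          one_mul]
        have : |x| / √(1 - x ^ 2) ≤ 1 / √(1 - d ^ 2) :=
          div_le_div₀ zero_le_one (hxd.le.trans hd1.le) hrd hle
        exact add_le_add (aux_fst_le u)
          (mul_le_mul this (aux_snd_le u) (abs_nonneg _) (by positivity))
      rw [← mul_assoc, Real.norm_eq_abs, abs_mul]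
      calc _ ≤ (K * auxP u ^ (2 * m)) * (s * (1 + 1 / √(1 - d ^ 2)) * auxP u) :=
            mul_le_mul b hw (abs_nonneg _) ((abs_nonneg _).trans b)
        _ = _ := by ring)
    ((aux_int2 _).const_mul _)
    (Filter.Eventually.of_forall fun u x hx => by
      have hxd : |x| < d := abs_lt.2 hx
      have hrx : 0 < 1 - x ^ 2 := by nlinarith [sq_abs x, abs_nonneg x]
      have hin : HasDerivAt (fun c' : ℝ => s * (c' * u.1 + √(1 - c' ^ 2) * u.2))
          (s * (u.1 + -(x / √(1 - x ^ 2)) * u.2)) x := by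
        have := (((hasDerivAt_id x).mul_const u.1).add
          ((aux_sqrt_deriv x hrx).mul_const u.2)).const_mul s
        simpa using this
      exact ((d0 _).comp x hin).const_mul (φ (s * u.1)))
  have hmain := main.2
  refine hmain.congr_deriv ?_
  clear hmain main
  set r := √(1 - c ^ 2) with hr_def
  have hr1c : |r| ≤ 1 := hr1 c
  -- Stein
  have bd := fun (A B : ℝ → ℝ) hA hB (u : ℝ × ℝ) =>
    aux_prod_bound A B C m hC hA hB s c r hs hcabs.le hr1c u
  have i01 : Integrable (fun u : ℝ × ℝ => φ (s * u.1) * deriv φ (s * (c * u.1 + r * u.2)))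
      ((gaussianReal 0 1).prod (gaussianReal 0 1)) :=
    aux_int3 K (2 * m) _ (by fun_prop) (bd φ (deriv φ) hb0 hb1)
  have i11 : Integrable (fun u : ℝ × ℝ => deriv φ (s * u.1) * deriv φ (s * (c * u.1 + r * u.2)))
      ((gaussianReal 0 1).prod (gaussianReal 0 1)) :=
    aux_int3 K (2 * m) _ (by fun_prop) (bd (deriv φ) (deriv φ) hb1 hb1)
  have i02 : Integrable
      (fun u : ℝ × ℝ => φ (s * u.1) * deriv (deriv φ) (s * (c * u.1 + r * u.2)))
      ((gaussianReal 0 1).prod (gaussianReal 0 1)) :=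
    aux_int3 K (2 * m) _ (by fun_prop) (bd φ (deriv (deriv φ)) hb0 hb2)
  have j1 : Integrable
      (fun u : ℝ × ℝ => u.1 * (φ (s * u.1) * deriv φ (s * (c * u.1 + r * u.2))))
      ((gaussianReal 0 1).prod (gaussianReal 0 1)) :=
    aux_int3 K (2 * m + 1) _ (by fun_prop) (fun u => by
      rw [abs_mul]
      calc _ ≤ auxP u * (K * auxP u ^ (2 * m)) :=
            mul_le_mul (aux_fst_le u) (bd φ (deriv φ) hb0 hb1 u) (abs_nonneg _)
              (zero_le_one.trans (one_le_auxP u))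
        _ = _ := by ring)
  have j2 : Integrable
      (fun u : ℝ × ℝ => u.2 * (φ (s * u.1) * deriv φ (s * (c * u.1 + r * u.2))))
      ((gaussianReal 0 1).prod (gaussianReal 0 1)) :=
    aux_int3 K (2 * m + 1) _ (by fun_prop) (fun u => by
      rw [abs_mul]
      calc _ ≤ auxP u * (K * auxP u ^ (2 * m)) :=
            mul_le_mul (aux_snd_le u) (bd φ (deriv φ) hb0 hb1 u) (abs_nonneg _)
              (zero_le_one.trans (one_le_auxP u))
        _ = _ := by ring)
  have s1 := aux_stein_fst _ (fun u : ℝ × ℝ =>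
      s * (deriv φ (s * u.1) * deriv φ (s * (c * u.1 + r * u.2)))
      + s * c * (φ (s * u.1) * deriv (deriv φ) (s * (c * u.1 + r * u.2))))
    (fun x y => by
      have e1 : HasDerivAt (fun t : ℝ => s * t) s x := by
        simpa using (hasDerivAt_id x).const_mul s
      have e2 : HasDerivAt (fun t : ℝ => s * (c * t + r * y)) (s * c) x := by
        simpa using (((hasDerivAt_id x).const_mul c).add_const (r * y)).const_mul s
      refine (((d0 _).comp x e1).mul ((d1 _).comp x e2)).congr_deriv ?_
      simp only [Function.comp]
      ring) i01 j1 ((i11.const_mul s).add (i02.const_mul (s * c)))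
  have s2 := aux_stein_snd _ (fun u : ℝ × ℝ =>
      s * r * (φ (s * u.1) * deriv (deriv φ) (s * (c * u.1 + r * u.2))))
    (fun x y => by
      have e2 : HasDerivAt (fun t : ℝ => s * (c * x + r * t)) (s * r) y := by
        simpa using (((hasDerivAt_id y).const_mul r).const_add (c * x)).const_mul s
      refine (((d1 _).comp y e2).const_mul (φ (s * x))).congr_deriv ?_
      ring) i01 j2 (i02.const_mul (s * r))
  rw [integral_add (i11.const_mul s) (i02.const_mul (s * c)), integral_const_mul,
    integral_const_mul] at s1
  rw [integral_const_mul] at s2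
  calc _ = ∫ u : ℝ × ℝ, (s * (u.1 * (φ (s * u.1) * deriv φ (s * (c * u.1 + r * u.2))))
          + (-(s * (c / r))) * (u.2 * (φ (s * u.1) * deriv φ (s * (c * u.1 + r * u.2)))))
          ∂((gaussianReal 0 1).prod (gaussianReal 0 1)) := by
        congr 1; ext u; ring
    _ = _ := by
        rw [integral_add (j1.const_mul s) (j2.const_mul _), integral_const_mul,
          integral_const_mul, s1, s2, ← hss]
        have hcr : s * (c / r) * (s * r) = s * (s * c) := by field_simp
        linear_combination (-(∫ u : ℝ × ℝ,
          φ (s * u.1) * deriv (deriv φ) (s * (c * u.1 + r * u.2))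
          ∂((gaussianReal 0 1).prod (gaussianReal 0 1)))) * hcr
end

section
/- Let n ≥ 2 and let Sym_n be the space of real symmetric n×n matrices with canonical basis {V_{α,α'}}_{0≤α≤α'≤n−1}, where V_{α,α'} has entry 1 at positions (α,α') and (α',α) and 0 elsewhere. Let χ_c, χ_q, κ ∈ ℝ with χ_q ≠ χ_c, and let J : Sym_n → Sym_n be the linear map determined by J V_{α,α'} = χ_c V_{α,α'} for α ≠ α' and J V_{α,α} = χ_q V_{α,α} + κ Σ_{α'≠α} V_{α,α'}. For each α define Ṽ_α = V_{α,α} + (κ/(χ_q − χ_c)) Σ_{α'≠α} V_{α,α'}. Then: (i) J Ṽ_α = χ_q Ṽ_α for every α; (ii) Sym_n is the direct sum of V_d = span{Ṽ_α : 0 ≤ α ≤ n−1} and V_od = span{V_{α,α'} : α ≠ α'}; and (iii) J acts on V_od as multiplication by χ_c. -/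
/-- Canonical symmetric basis matrix `V_{α,α'}`, with entry 1 at positions `(α,α')`
and `(α',α)` and 0 elsewhere. -/
noncomputable def Vb (n : ℕ) (α α' : Fin n) : Matrix (Fin n) (Fin n) ℝ :=
  Matrix.of fun a b =>
    if (a = α ∧ b = α') ∨ (a = α' ∧ b = α) then (1 : ℝ) else 0

/-- The modified diagonal vectors `Ṽ_α = V_{α,α} + (κ/(χ_q − χ_c)) ∑_{α'≠α} V_{α,α'}`. -/
noncomputable def Vt (n : ℕ) (χc χq κ : ℝ) (α : Fin n) : Matrix (Fin n) (Fin n) ℝ :=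
  Vb n α α + (κ / (χq - χc)) • ∑ α' ∈ Finset.univ.filter (· ≠ α), Vb n α α'

theorem Vb_symm_aux (n : ℕ) (a b : Fin n) : (Vb n a b).IsSymm := by
  ext i j
  simp only [Vb, Matrix.transpose_apply, Matrix.of_apply]
  congr 1
  apply propext
  tauto

theorem Vt_symm_aux (n : ℕ) (χc χq κ : ℝ) (a : Fin n) : (Vt n χc χq κ a).IsSymm := by
  unfold Vt Matrix.IsSymm
  rw [Matrix.transpose_add, Matrix.transpose_smul, Matrix.transpose_sum]
  simp only [(Vb_symm_aux n _ _).eq]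

theorem Vb_diag_aux (n : ℕ) (a b i : Fin n) (h : a ≠ b) : Vb n a b i i = 0 := by
  simp only [Vb, Matrix.of_apply]
  rw [if_neg]
  rintro (⟨h1, h2⟩ | ⟨h1, h2⟩)
  · exact h (h1.symm.trans h2)
  · exact h (h2.symm.trans h1)

theorem Vt_diag_aux (n : ℕ) (χc χq κ : ℝ) (a i : Fin n) :
    Vt n χc χq κ a i i = if i = a then 1 else 0 := by
  have h0 : ∑ b ∈ Finset.univ.filter (· ≠ a), Vb n a b i i = 0 := by
    apply Finset.sum_eq_zero
    intro b hb
    exact Vb_diag_aux n a b i (Finset.mem_filter.mp hb).2.symm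
  simp only [Vt, Matrix.add_apply, Matrix.smul_apply, Matrix.sum_apply, h0]
  simp [Vb]

theorem Vd_repr_aux (n : ℕ) (χc χq κ : ℝ) (D : Matrix (Fin n) (Fin n) ℝ)
    (hD : D ∈ Submodule.span ℝ (Set.range (Vt n χc χq κ))) :
    D = ∑ a, D a a • Vt n χc χq κ a := by
  induction hD using Submodule.span_induction with
  | mem x hx =>
    obtain ⟨b, rfl⟩ := hx
    simp [Vt_diag_aux]
  | zero => simp
  | add x y _ _ hx hy =>
    simp only [Matrix.add_apply, add_smul, Finset.sum_add_distrib]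
    rw [← hx, ← hy]
  | smul c x _ hx =>
    simp only [Matrix.smul_apply, smul_assoc, ← Finset.smul_sum]
    rw [← hx]

theorem Vod_diag_aux (n : ℕ) (M : Matrix (Fin n) (Fin n) ℝ)
    (hM : M ∈ Submodule.span ℝ
      {M : Matrix (Fin n) (Fin n) ℝ | ∃ α α' : Fin n, α ≠ α' ∧ M = Vb n α α'}) (i : Fin n) :
    M i i = 0 := by
  induction hM using Submodule.span_induction with
  | mem x hx =>
    obtain ⟨a, b, hab, rfl⟩ := hx
    exact Vb_diag_aux n a b i hab
  | zero => simp
  | add x y _ _ hx hy => simp [hx, hy]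
  | smul c x _ hx => simp [hx]

theorem Vod_mem_aux (n : ℕ) (M : Matrix (Fin n) (Fin n) ℝ) (hs : M.IsSymm)
    (hd : ∀ i, M i i = 0) :
    M ∈ Submodule.span ℝ
      {M : Matrix (Fin n) (Fin n) ℝ | ∃ α α' : Fin n, α ≠ α' ∧ M = Vb n α α'} := by
  have key : M = ∑ a, ∑ b, (M a b / 2) • (Matrix.single a b (1 : ℝ) + Matrix.single b a 1) := by
    ext i j
    have := hs.apply i j
    simp [Matrix.sum_apply, Matrix.single_apply, mul_add, Finset.sum_add_distrib, ite_and, this]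
  rw [key]
  refine Submodule.sum_mem _ fun a _ => Submodule.sum_mem _ fun b _ => ?_
  by_cases hab : a = b
  · subst hab
    simp [hd]
  · refine Submodule.smul_mem _ _ (Submodule.subset_span ⟨a, b, hab, ?_⟩)
    ext i j
    simp only [Vb, Matrix.add_apply, Matrix.single_apply, Matrix.of_apply]
    grind

/-- Eigen-decomposition of the Jacobian `J` of the mean-field C-map: with
`J V_{α,α'} = χ_c V_{α,α'}` for `α ≠ α'` and
`J V_{α,α} = χ_q V_{α,α} + κ ∑_{α'≠α} V_{α,α'}`, and `χ_q ≠ χ_c`: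
(i) `J Ṽ_α = χ_q Ṽ_α`; (ii) every symmetric matrix decomposes uniquely as a sum of an
element of `V_d = span{Ṽ_α}` and an element of `V_od = span{V_{α,α'} : α ≠ α'}`;
(iii) `J` acts on `V_od` as multiplication by `χ_c`. -/
theorem stmt9
    (n : ℕ) (hn : 2 ≤ n) (χc χq κ : ℝ) (hne : χq ≠ χc)
    (J : Matrix (Fin n) (Fin n) ℝ →ₗ[ℝ] Matrix (Fin n) (Fin n) ℝ)
    (hod : ∀ α α' : Fin n, α ≠ α' → J (Vb n α α') = χc • Vb n α α')
    (hdg : ∀ α : Fin n,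
      J (Vb n α α) =
        χq • Vb n α α + κ • ∑ α' ∈ Finset.univ.filter (· ≠ α), Vb n α α') :
    (∀ α : Fin n, J (Vt n χc χq κ α) = χq • Vt n χc χq κ α) ∧
    (∀ U : Matrix (Fin n) (Fin n) ℝ, U.IsSymm →
      ∃! p : Matrix (Fin n) (Fin n) ℝ × Matrix (Fin n) (Fin n) ℝ,
        p.1 ∈ Submodule.span ℝ (Set.range (Vt n χc χq κ)) ∧
        p.2 ∈ Submodule.span ℝ
          {M : Matrix (Fin n) (Fin n) ℝ | ∃ α α' : Fin n, α ≠ α' ∧ M = Vb n α α'} ∧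
        U = p.1 + p.2) ∧
    (∀ U ∈ Submodule.span ℝ
        {M : Matrix (Fin n) (Fin n) ℝ | ∃ α α' : Fin n, α ≠ α' ∧ M = Vb n α α'},
      J U = χc • U) := by
  refine ⟨?_, ?_, ?_⟩
  · intro α
    have hs : J (∑ α' ∈ Finset.univ.filter (· ≠ α), Vb n α α') =
        χc • ∑ α' ∈ Finset.univ.filter (· ≠ α), Vb n α α' := by
      rw [map_sum, Finset.smul_sum]
      apply Finset.sum_congr rfl
      intro b hb
      exact hod α b (Finset.mem_filter.mp hb).2.symm
    have h0 : χq - χc ≠ 0 := sub_ne_zero.mpr hne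
    rw [Vt, map_add, map_smul, hs, hdg, smul_add, add_assoc, smul_smul, smul_smul, ← add_smul]
    congr 2
    field_simp
    ring
  · intro U hU
    have hD : ∑ a, U a a • Vt n χc χq κ a ∈ Submodule.span ℝ (Set.range (Vt n χc χq κ)) :=
      Submodule.sum_mem _ fun a _ => Submodule.smul_mem _ _ (Submodule.subset_span ⟨a, rfl⟩)
    refine ⟨(∑ a, U a a • Vt n χc χq κ a, U - ∑ a, U a a • Vt n χc χq κ a), ⟨hD, ?_, ?_⟩, ?_⟩
    · apply Vod_mem_aux
      · unfold Matrix.IsSymm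
        simp only [Matrix.transpose_sub, Matrix.transpose_sum, Matrix.transpose_smul,
          (Vt_symm_aux n χc χq κ _).eq, hU.eq]
      · intro i
        simp [Matrix.sum_apply, Vt_diag_aux]
    · simp
    · rintro ⟨D, M⟩ ⟨h1, h2, h3⟩
      simp only at h1 h2 h3
      have hdiag : ∀ a, U a a = D a a := by
        intro a
        rw [h3, Matrix.add_apply, Vod_diag_aux n M h2, add_zero]
      have h4 : D = ∑ a, U a a • Vt n χc χq κ a := by
        simp only [hdiag]
        exact Vd_repr_aux n χc χq κ D h1
      rw [← h4, h3]
      simp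
  · intro U hU
    induction hU using Submodule.span_induction with
    | mem x hx =>
      obtain ⟨a, b, hab, rfl⟩ := hx
      exact hod a b hab
    | zero => simp
    | add x y _ _ hx hy => rw [map_add, hx, hy, smul_add]
    | smul c x _ hx => rw [map_smul, hx, smul_comm]
end

section
/- Let c₁, c₂, c₃ and n be positive integers. Let K : ℤ → ℝ^{c₃×c₂} and C : ℤ → ℝ^{c₂×c₁} be finitely supported matrix-valued kernels, and define their block-wise convolution K □ C : ℤ → ℝ^{c₃×c₁} by (K □ C)(γ) = Σ_{β∈ℤ} K(β) C(γ−β). For a periodic signal x : ℤ/nℤ → ℝ^{c₁} and a kernel M, define the circular convolution (M ∗ x)(α) = Σ_{β∈ℤ} M(β) x(α−β), index α−β taken mod n. Then for every x : ℤ/nℤ → ℝ^{c₁}, ((K □ C) ∗ x) = K ∗ (C ∗ x). -/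
/-- Circular convolution of a finitely supported matrix-valued kernel
`M : ℤ → ℝ^{a×b}` with a periodic signal `x : ℤ/nℤ → ℝ^b`:
`(M ∗ x)(α) = ∑_β M(β) x(α−β)`, the index `α−β` taken mod `n`. -/
noncomputable def circConv {n a b : ℕ} (M : ℤ → Matrix (Fin a) (Fin b) ℝ)
    (x : ZMod n → Fin b → ℝ) : ZMod n → Fin a → ℝ :=
  fun α => ∑ᶠ β : ℤ, (M β).mulVec (x (α - (β : ZMod n)))

/-- Block-wise convolution of matrix-valued kernels:
`(K □ C)(γ) = ∑_β K(β) C(γ−β)`. -/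
noncomputable def blockConv {a b c : ℕ} (K : ℤ → Matrix (Fin c) (Fin b) ℝ)
    (C : ℤ → Matrix (Fin b) (Fin a) ℝ) : ℤ → Matrix (Fin c) (Fin a) ℝ :=
  fun γ => ∑ᶠ β : ℤ, K β * C (γ - β)

/-- Block-wise convolution of kernels corresponds to composition of the associated
periodic convolution operators: `(K □ C) ∗ x = K ∗ (C ∗ x)` for every periodic
signal `x`. -/
theorem stmt14
    (c₁ c₂ c₃ n : ℕ) (hc₁ : 0 < c₁) (hc₂ : 0 < c₂) (hc₃ : 0 < c₃) (hn : 0 < n)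
    (K : ℤ → Matrix (Fin c₃) (Fin c₂) ℝ) (C : ℤ → Matrix (Fin c₂) (Fin c₁) ℝ)
    (hK : (Function.support K).Finite) (hC : (Function.support C).Finite) :
    ∀ x : ZMod n → Fin c₁ → ℝ,
      circConv (blockConv K C) x = circConv K (circConv C x) := by
  intro x
  funext α
  have hT : ∀ (β : ℤ), (Function.support fun γ : ℤ =>
      (K β * C (γ - β)).mulVec (x (α - (γ : ZMod n)))).Finite := by
    intro β
    refine (hC.image (fun δ => δ + β)).subset ?_
    intro γ hγ
    refine ⟨γ - β, ?_, by simp⟩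
    intro h
    apply hγ
    simp [h]
  have hb : ∀ γ, blockConv K C γ = ∑ β ∈ hK.toFinset, K β * C (γ - β) := by
    intro γ
    unfold blockConv
    apply finsum_eq_finset_sum_of_support_subset
    intro β hβ
    simp only [Set.Finite.coe_toFinset]
    intro h
    apply hβ
    simp [h]
  have hR : circConv K (circConv C x) α = ∑ β ∈ hK.toFinset,
      (K β).mulVec (circConv C x (α - (β : ZMod n))) := by
    rw [circConv]
    apply finsum_eq_finset_sum_of_support_subset
    intro β hβ
    simp only [Set.Finite.coe_toFinset]
    intro h
    apply hβ
    simp [h]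
  rw [hR]
  have hL : circConv (blockConv K C) x α = ∑ᶠ γ : ℤ, ∑ β ∈ hK.toFinset,
      (K β * C (γ - β)).mulVec (x (α - (γ : ZMod n))) := by
    rw [circConv]
    apply finsum_congr
    intro γ
    rw [hb, Matrix.sum_mulVec]
  rw [hL, finsum_sum_comm _ _ (fun β _ => hT β)]
  refine Finset.sum_congr rfl fun β _ => ?_
  rw [← finsum_comp_equiv (Equiv.addRight β), circConv]
  have hf : (Function.support fun δ : ℤ =>
      (C δ).mulVec (x (α - (β : ZMod n) - (δ : ZMod n)))).Finite := by
    refine hC.subset ?_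
    intro δ hδ h
    apply hδ
    simp [h]
  have := (Matrix.mulVecLin (K β)).toAddMonoidHom.map_finsum hf
  simp only [LinearMap.toAddMonoidHom_coe, Matrix.mulVecLin_apply] at this
  rw [this]
  apply finsum_congr
  intro δ
  have e : α - ((δ + β : ℤ) : ZMod n) = α - (β : ZMod n) - (δ : ZMod n) := by
    push_cast
    ring
  simp only [Equiv.coe_addRight, add_sub_cancel_right, Matrix.mulVec_mulVec, e]
end

section
/- Let c₁, c₂, c₃ and n be positive integers. Let K : ℤ → ℝ^{c₃×c₂} and C : ℤ → ℝ^{c₂×c₁} be finitely supported matrix-valued kernels, with circular convolution (M ∗ x)(α) = Σ_β M(β) x(α−β) (index mod n) and block convolution (K □ C)(γ) = Σ_β K(β) C(γ−β). Suppose K and C are orthogonal kernels for spatial size n, i.e. ‖K ∗ y‖₂ = ‖y‖₂ for every y : ℤ/nℤ → ℝ^{c₂} and ‖C ∗ x‖₂ = ‖x‖₂ for every x : ℤ/nℤ → ℝ^{c₁}, where ‖·‖₂ is the Euclidean norm on the concatenated entries. Then K □ C is an orthogonal kernel: ‖(K □ C) ∗ x‖₂ = ‖x‖₂ for every x : ℤ/nℤ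 → ℝ^{c₁}. -/
theorem circConv_blockConv_aux {c₁ c₂ c₃ n : ℕ}
    (K : ℤ → Matrix (Fin c₃) (Fin c₂) ℝ) (C : ℤ → Matrix (Fin c₂) (Fin c₁) ℝ)
    (hK : (Function.support K).Finite) (hC : (Function.support C).Finite)
    (x : ZMod n → Fin c₁ → ℝ) :
    circConv (blockConv K C) x = circConv K (circConv C x) := by
  funext α
  have hb : ∀ γ, blockConv K C γ = ∑ β ∈ hK.toFinset, K β * C (γ - β) := by
    intro γ
    refine finsum_eq_sum_of_support_subset _ ?_
    intro β hβ
    simp only [Set.Finite.coe_toFinset, Function.mem_support] at hβ ⊢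
    intro h
    exact hβ (by rw [h, Matrix.zero_mul])
  have hfin : ∀ α : ZMod n,
      (Function.support fun δ : ℤ => (C δ).mulVec (x (α - (δ : ZMod n)))).Finite := by
    intro α
    refine hC.subset ?_
    intro δ hδ
    simp only [Function.mem_support] at hδ ⊢
    intro h
    exact hδ (by rw [h, Matrix.zero_mulVec])
  have hR : circConv K (circConv C x) α =
      ∑ β ∈ hK.toFinset, (K β).mulVec (circConv C x (α - (β : ZMod n))) := by
    refine finsum_eq_sum_of_support_subset _ ?_
    intro β hβ
    simp only [Set.Finite.coe_toFinset, Function.mem_support] at hβ ⊢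
    intro h
    exact hβ (by rw [h, Matrix.zero_mulVec])
  have hL : circConv (blockConv K C) x α =
      ∑ᶠ γ : ℤ, ∑ β ∈ hK.toFinset, (K β * C (γ - β)).mulVec (x (α - (γ : ZMod n))) := by
    unfold circConv
    refine finsum_congr fun γ => ?_
    rw [hb, Matrix.sum_mulVec]
  rw [hL, hR, finsum_sum_comm]
  · refine Finset.sum_congr rfl fun β _ => ?_
    rw [← finsum_comp_equiv (Equiv.addRight β)]
    have := (Matrix.mulVecLin (K β)).toAddMonoidHom.map_finsum (hfin (α - (β : ZMod n)))
    refine Eq.trans ?_ this.symm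
    refine finsum_congr fun δ => ?_
    simp [Matrix.mulVec_mulVec, sub_sub, add_comm]
  · intro β _
    refine (hC.image (· + β)).subset ?_
    intro γ hγ
    refine ⟨γ - β, ?_, by simp⟩
    simp only [Function.mem_support] at hγ ⊢
    intro h
    exact hγ (by rw [h, Matrix.mul_zero, Matrix.zero_mulVec])

/-- If `K` and `C` are orthogonal kernels for spatial size `n` (their periodic
convolutions preserve the Euclidean norm), then the block-wise convolution `K □ C`
is an orthogonal kernel. -/
theorem stmt15
    (c₁ c₂ c₃ n : ℕ) (hc₁ : 0 < c₁) (hc₂ : 0 < c₂) (hc₃ : 0 < c₃) [NeZero n]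
    (K : ℤ → Matrix (Fin c₃) (Fin c₂) ℝ) (C : ℤ → Matrix (Fin c₂) (Fin c₁) ℝ)
    (hK : (Function.support K).Finite) (hC : (Function.support C).Finite)
    (hKorth : ∀ y : ZMod n → Fin c₂ → ℝ,
      ∑ α : ZMod n, ∑ j : Fin c₃, circConv K y α j ^ 2 =
        ∑ α : ZMod n, ∑ j : Fin c₂, y α j ^ 2)
    (hCorth : ∀ x : ZMod n → Fin c₁ → ℝ,
      ∑ α : ZMod n, ∑ j : Fin c₂, circConv C x α j ^ 2 =
        ∑ α : ZMod n, ∑ j : Fin c₁, x α j ^ 2) :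
    ∀ x : ZMod n → Fin c₁ → ℝ,
      ∑ α : ZMod n, ∑ j : Fin c₃, circConv (blockConv K C) x α j ^ 2 =
        ∑ α : ZMod n, ∑ j : Fin c₁, x α j ^ 2 := by
  intro x
  rw [circConv_blockConv_aux K C hK hC x, hKorth, hCorth]
end

section
/- Let c and n be positive integers and let P ∈ ℝ^{c×c} be an orthogonal projection (P = Pᵀ and P² = P). Define the kernel K : ℤ → ℝ^{c×c} supported on {0,1} by K(0) = P and K(1) = I − P, where I is the c×c identity. Then for every x : ℤ/nℤ → ℝ^{c}, the circular convolution (K ∗ x)(α) = P x(α) + (I − P) x(α−1) (index mod n) satisfies Σ_{α∈ℤ/nℤ} ‖(K ∗ x)(α)‖₂² = Σ_{α∈ℤ/nℤ} ‖x(α)‖₂². -/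
lemma proj_step (c : ℕ) (P : Matrix (Fin c) (Fin c) ℝ)
    (hsym : P.transpose = P) (hidem : P * P = P) (x y : Fin c → ℝ) :
    ∑ j : Fin c, (P.mulVec x + ((1 : Matrix (Fin c) (Fin c) ℝ) - P).mulVec y) j ^ 2 =
      x ⬝ᵥ P.mulVec x + (y ⬝ᵥ y - y ⬝ᵥ P.mulVec y) := by
  have key : ∀ u v : Fin c → ℝ, P.mulVec u ⬝ᵥ v = u ⬝ᵥ P.mulVec v := by
    intro u v
    rw [Matrix.dotProduct_mulVec, ← Matrix.mulVec_transpose, hsym]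
  have h2 : ∀ v : Fin c → ℝ, P.mulVec (P.mulVec v) = P.mulVec v := by
    intro v
    rw [Matrix.mulVec_mulVec, hidem]
  have h : ∀ w : Fin c → ℝ, ∑ j, w j ^ 2 = w ⬝ᵥ w := by
    intro w
    simp [dotProduct, sq]
  rw [h, Matrix.sub_mulVec, Matrix.one_mulVec]
  simp only [add_dotProduct, dotProduct_add, sub_dotProduct, dotProduct_sub, key, h2]
  ring

/-- The basic 1D orthogonal building block: for an orthogonal projection `P`
(`P = Pᵀ`, `P² = P`), circular convolution with the two-tap kernel `(P, I−P)`,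
`(K ∗ x)(α) = P x(α) + (I−P) x(α−1)`, preserves the Euclidean norm of every
periodic signal `x : ℤ/nℤ → ℝ^c`. -/
theorem stmt16
    (c n : ℕ) (hc : 0 < c) [NeZero n]
    (P : Matrix (Fin c) (Fin c) ℝ)
    (hsym : P.transpose = P) (hidem : P * P = P) :
    ∀ x : ZMod n → Fin c → ℝ,
      ∑ α : ZMod n, ∑ j : Fin c,
          (P.mulVec (x α) + ((1 : Matrix (Fin c) (Fin c) ℝ) - P).mulVec (x (α - 1))) j ^ 2 =
        ∑ α : ZMod n, ∑ j : Fin c, x α j ^ 2 := by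
  intro x
  simp_rw [proj_step c P hsym hidem]
  have hs := (Equiv.subRight (1 : ZMod n)).sum_comp
      (fun α => x α ⬝ᵥ x α - x α ⬝ᵥ P.mulVec (x α))
  simp only [Equiv.subRight_apply] at hs
  rw [Finset.sum_add_distrib, hs, ← Finset.sum_add_distrib]
  refine Finset.sum_congr rfl fun α _ => ?_
  simp [dotProduct, sq]
end

section
/- Let c and n be positive integers and let P, Q ∈ ℝ^{c×c} be orthogonal projections (symmetric idempotents). Define the 2D kernel B : ℤ² → ℝ^{c×c} supported on {0,1}² by B(0,0) = PQ, B(0,1) = P(I−Q), B(1,0) = (I−P)Q, B(1,1) = (I−P)(I−Q). Then for every x : (ℤ/nℤ)² → ℝ^{c}, the 2D circular convolution (B ∗ x)(α,α') = Σ_{β,β'∈{0,1}} B(β,β') x(α−β, α'−β') (indices mod n) satisfies Σ_{α,α'} ‖(B ∗ x)(α,α')‖₂² = Σ_{α,α'} ‖x(α,α')‖₂². The projections P and Q need not commute. -/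
theorem aux_pyth {c : ℕ} (P : Matrix (Fin c) (Fin c) ℝ)
    (hs : P.transpose = P) (hi : P * P = P) (u v : Fin c → ℝ) :
    ∑ j, (P.mulVec u + ((1 : Matrix (Fin c) (Fin c) ℝ) - P).mulVec v) j ^ 2 =
      ∑ j, (P.mulVec u) j ^ 2 + ∑ j, (((1 : Matrix (Fin c) (Fin c) ℝ) - P).mulVec v) j ^ 2 := by
  have h : dotProduct (P.mulVec u) (((1 : Matrix (Fin c) (Fin c) ℝ) - P).mulVec v) = 0 := by
    rw [← Matrix.vecMul_transpose, hs, ← Matrix.dotProduct_mulVec, Matrix.mulVec_mulVec,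
      mul_sub, hi]
    simp
  unfold dotProduct at h
  have h2 : ∀ a b : Fin c → ℝ, ∑ j, (a + b) j ^ 2 =
      ∑ j, a j ^ 2 + ∑ j, b j ^ 2 + 2 * ∑ j, a j * b j := by
    intro a b
    rw [Finset.mul_sum, ← Finset.sum_add_distrib, ← Finset.sum_add_distrib]
    refine Finset.sum_congr rfl fun j _ => ?_
    simp only [Pi.add_apply]
    ring
  rw [h2, h]
  ring

theorem aux_iso {c n : ℕ} [NeZero n] (P : Matrix (Fin c) (Fin c) ℝ)
    (hs : P.transpose = P) (hi : P * P = P) (y : ZMod n → Fin c → ℝ) :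
    ∑ α, ∑ j, (P.mulVec (y α) + ((1 : Matrix (Fin c) (Fin c) ℝ) - P).mulVec (y (α - 1))) j ^ 2 =
      ∑ α, ∑ j, y α j ^ 2 := by
  simp only [aux_pyth P hs hi]
  have hshift : ∑ α : ZMod n,
      ∑ j, (((1 : Matrix (Fin c) (Fin c) ℝ) - P).mulVec (y (α - 1))) j ^ 2 =
      ∑ α : ZMod n, ∑ j, (((1 : Matrix (Fin c) (Fin c) ℝ) - P).mulVec (y α)) j ^ 2 :=
    (Equiv.subRight (1 : ZMod n)).sum_comp
      (fun α => ∑ j, (((1 : Matrix (Fin c) (Fin c) ℝ) - P).mulVec (y α)) j ^ 2)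
  rw [Finset.sum_add_distrib, hshift, ← Finset.sum_add_distrib]
  refine Finset.sum_congr rfl fun α _ => ?_
  rw [← aux_pyth P hs hi, ← Matrix.add_mulVec]
  simp

/-- The 2×2 block of projection products used in Algorithm 1: for orthogonal
projections `P, Q` (symmetric idempotents, not necessarily commuting), the 2D circular
convolution with the kernel `B(0,0) = PQ`, `B(0,1) = P(I−Q)`, `B(1,0) = (I−P)Q`,
`B(1,1) = (I−P)(I−Q)` preserves the Euclidean norm of every periodic 2D signal. -/
theorem stmt17
    (c n : ℕ) (hc : 0 < c) [NeZero n]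
    (P Q : Matrix (Fin c) (Fin c) ℝ)
    (hPsym : P.transpose = P) (hPidem : P * P = P)
    (hQsym : Q.transpose = Q) (hQidem : Q * Q = Q) :
    ∀ x : ZMod n → ZMod n → Fin c → ℝ,
      ∑ α : ZMod n, ∑ α' : ZMod n, ∑ j : Fin c,
          ((P * Q).mulVec (x α α') +
            (P * ((1 : Matrix (Fin c) (Fin c) ℝ) - Q)).mulVec (x α (α' - 1)) +
            (((1 : Matrix (Fin c) (Fin c) ℝ) - P) * Q).mulVec (x (α - 1) α') +
            (((1 : Matrix (Fin c) (Fin c) ℝ) - P) *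
              ((1 : Matrix (Fin c) (Fin c) ℝ) - Q)).mulVec (x (α - 1) (α' - 1))) j ^ 2 =
        ∑ α : ZMod n, ∑ α' : ZMod n, ∑ j : Fin c, x α α' j ^ 2 := by
  intro x
  have e : ∀ α α' : ZMod n, (P * Q).mulVec (x α α') +
            (P * ((1 : Matrix (Fin c) (Fin c) ℝ) - Q)).mulVec (x α (α' - 1)) +
            (((1 : Matrix (Fin c) (Fin c) ℝ) - P) * Q).mulVec (x (α - 1) α') +
            (((1 : Matrix (Fin c) (Fin c) ℝ) - P) *
              ((1 : Matrix (Fin c) (Fin c) ℝ) - Q)).mulVec (x (α - 1) (α' - 1)) =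
      P.mulVec (Q.mulVec (x α α') + ((1 : Matrix (Fin c) (Fin c) ℝ) - Q).mulVec (x α (α' - 1))) +
      ((1 : Matrix (Fin c) (Fin c) ℝ) - P).mulVec (Q.mulVec (x (α - 1) α') +
        ((1 : Matrix (Fin c) (Fin c) ℝ) - Q).mulVec (x (α - 1) (α' - 1))) := by
    intro α α'
    rw [Matrix.mulVec_add, Matrix.mulVec_add]
    simp only [Matrix.mulVec_mulVec]
    abel
  simp only [e]
  rw [Finset.sum_comm]
  have h1 := fun α' : ZMod n => aux_iso P hPsym hPidem (fun α => Q.mulVec (x α α') +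
    ((1 : Matrix (Fin c) (Fin c) ℝ) - Q).mulVec (x α (α' - 1)))
  rw [Finset.sum_congr rfl fun α' _ => h1 α', Finset.sum_comm]
  exact Finset.sum_congr rfl fun α _ => aux_iso Q hQsym hQidem (x α)
end

section
/- Let c_in ≤ c_out and n be positive integers, let H ∈ ℝ^{c_in×c_out} satisfy H Hᵀ = I_{c_in} (orthonormal rows), and let K : ℤ² → ℝ^{c_out×c_out} be a finitely supported kernel that is orthogonal for spatial size n, i.e. Σ_{α,α'} ‖(K ∗ y)(α,α')‖₂² = Σ_{α,α'} ‖y(α,α')‖₂² for every y : (ℤ/nℤ)² → ℝ^{c_out}, where (K ∗ y)(α,α') = Σ_{β,β'} K(β,β') y(α−β,α'−β'). Define the kernel M : ℤ² → ℝ^{c_in×c_out} by M(β,β') = H K(β,β'), and the associated convolution acting on x : (ℤ/nℤ)² → ℝ^{c_in} by (M ∗ᵀ x)(α,α') = Σ_{β,β'} M(β,β')ᵀ x(α−β, α'−β') ∈ ℝ^{c_out}. Then Σ_{α,α'} ‖(M ∗ᵀ x)(α,α')‖₂² = Σ_{α,α'} ‖x(α,α')‖₂² for every x : (ℤ/nℤ)²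 → ℝ^{c_in}. -/
/-- 2D circular convolution of a finitely supported matrix-valued kernel with a
periodic 2D signal: `(M ∗ y)(α,α') = ∑_{β,β'} M(β,β') y(α−β, α'−β')`, indices mod `n`. -/
noncomputable def circConv2 {n a b : ℕ} (M : ℤ × ℤ → Matrix (Fin a) (Fin b) ℝ)
    (y : ZMod n → ZMod n → Fin b → ℝ) : ZMod n → ZMod n → Fin a → ℝ :=
  fun α α' => ∑ᶠ β : ℤ × ℤ,
    (M β).mulVec (y (α - (β.1 : ZMod n)) (α' - (β.2 : ZMod n)))

open Matrix in
lemma aux_orth {ι : Type*} [Fintype ι] [DecidableEq ι] (A : Matrix ι ι ℝ)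
    (h : ∀ v : ι → ℝ, (A *ᵥ v) ⬝ᵥ (A *ᵥ v) = v ⬝ᵥ v) : Aᵀ * A = 1 := by
  have h2 : ∀ u w : ι → ℝ, (A *ᵥ u) ⬝ᵥ (A *ᵥ w) = u ⬝ᵥ w := by
    intro u w
    have h1 := h (u + w)
    have hu := h u
    have hw := h w
    simp only [mulVec_add, add_dotProduct, dotProduct_add] at h1
    have c1 := dotProduct_comm (A *ᵥ w) (A *ᵥ u)
    have c2 := dotProduct_comm w u
    linarith
  ext p q
  have := h2 (Pi.single p 1) (Pi.single q 1)
  simp only [mulVec_single_one] at this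
  rw [Matrix.mul_apply, Matrix.one_apply]
  simp [dotProduct, Pi.single_apply] at this
  simpa [Matrix.transpose_apply, eq_comm] using this

/-- kernel folded modulo n -/
noncomputable def foldK {n a b : ℕ} (S : Finset (ℤ × ℤ)) (M : ℤ × ℤ → Matrix (Fin a) (Fin b) ℝ)
    (g : ZMod n × ZMod n) : Matrix (Fin a) (Fin b) ℝ :=
  ∑ β ∈ S, if ((β.1 : ZMod n), (β.2 : ZMod n)) = g then M β else 0

/-- block circulant matrix -/
noncomputable def circM {n a b : ℕ} (S : Finset (ℤ × ℤ)) (M : ℤ × ℤ → Matrix (Fin a) (Fin b) ℝ) :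
    Matrix ((ZMod n × ZMod n) × Fin a) ((ZMod n × ZMod n) × Fin b) ℝ :=
  Matrix.of fun p q => foldK S M (p.1 - q.1) p.2 q.2

open Matrix in
lemma conv_eq {n a b : ℕ} [NeZero n] (S : Finset (ℤ × ℤ))
    (M : ℤ × ℤ → Matrix (Fin a) (Fin b) ℝ) (hS : ∀ β, M β ≠ 0 → β ∈ S)
    (y : ZMod n → ZMod n → Fin b → ℝ) (p : (ZMod n × ZMod n) × Fin a) :
    circConv2 M y p.1.1 p.1.2 p.2 =
      (circM S M *ᵥ (fun q : (ZMod n × ZMod n) × Fin b => y q.1.1 q.1.2 q.2)) p := by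
  obtain ⟨⟨α, α'⟩, j⟩ := p
  unfold circConv2
  have hsub : Function.support (fun β : ℤ × ℤ =>
      (M β).mulVec (y (α - (β.1 : ZMod n)) (α' - (β.2 : ZMod n)))) ⊆ (S : Set (ℤ × ℤ)) := by
    intro β hβ
    refine hS β fun h0 => hβ ?_
    simp [h0]
  dsimp only
  rw [finsum_eq_sum_of_support_subset _ hsub]
  · simp only [Finset.sum_apply, mulVec, dotProduct, circM, foldK, Matrix.of_apply,
      Matrix.sum_apply, Finset.sum_mul]
    conv_rhs => rw [Finset.sum_comm]
    refine Finset.sum_congr rfl fun β _ => ?_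
    rw [Fintype.sum_prod_type, Finset.sum_eq_single (α - (β.1 : ZMod n), α' - (β.2 : ZMod n))]
    · simp
    · rintro ⟨g, g'⟩ _ hne
      refine Finset.sum_eq_zero fun i _ => ?_
      rw [if_neg]
      · simp
      · intro h
        apply hne
        simp only [Prod.mk_sub_mk, Prod.mk.injEq] at h ⊢
        rw [h.1, h.2]
        simp
    · simp

lemma sum_flat {n a : ℕ} [NeZero n] (f : ZMod n → ZMod n → Fin a → ℝ) :
    ∑ α : ZMod n, ∑ α' : ZMod n, ∑ j : Fin a, f α α' j =
      ∑ p : (ZMod n × ZMod n) × Fin a, f p.1.1 p.1.2 p.2 := by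
  simp [Fintype.sum_prod_type]

/-- Step 3 of Algorithm 1: if `H` has orthonormal rows (`H Hᵀ = I`) and `K` is an
orthogonal `c_out → c_out` kernel, then the kernel `M(β,β') = H K(β,β')`, acting on
`c_in`-channel signals by `(M ∗ᵀ x)(α,α') = ∑_{β,β'} M(β,β')ᵀ x(α−β, α'−β')`, is
norm-preserving. -/
theorem stmt18
    (cin cout n : ℕ) (hcc : cin ≤ cout) (hcin : 0 < cin) [NeZero n]
    (H : Matrix (Fin cin) (Fin cout) ℝ)
    (hH : H * H.transpose = 1)
    (K : ℤ × ℤ → Matrix (Fin cout) (Fin cout) ℝ)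
    (hKfin : (Function.support K).Finite)
    (hKorth : ∀ y : ZMod n → ZMod n → Fin cout → ℝ,
      ∑ α : ZMod n, ∑ α' : ZMod n, ∑ j : Fin cout, circConv2 K y α α' j ^ 2 =
        ∑ α : ZMod n, ∑ α' : ZMod n, ∑ j : Fin cout, y α α' j ^ 2) :
    ∀ x : ZMod n → ZMod n → Fin cin → ℝ,
      ∑ α : ZMod n, ∑ α' : ZMod n, ∑ j : Fin cout,
          (∑ᶠ β : ℤ × ℤ, ((H * K β).transpose).mulVec
            (x (α - (β.1 : ZMod n)) (α' - (β.2 : ZMod n)))) j ^ 2 =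
        ∑ α : ZMod n, ∑ α' : ZMod n, ∑ j : Fin cin, x α α' j ^ 2 := by
  intro x
  classical
  set S := hKfin.toFinset with hSdef
  have hS : ∀ β, K β ≠ 0 → β ∈ S := fun β h => by simpa [hSdef] using h
  have hA : (circM (n := n) S K).transpose * circM S K = 1 := by
    apply aux_orth
    intro v
    have h := hKorth (fun a a' i => v ((a, a'), i))
    rw [sum_flat (fun α α' j => circConv2 K (fun a a' i => v ((a, a'), i)) α α' j ^ 2),
      sum_flat (fun α α' j => v ((α, α'), j) ^ 2)] at h
    simp only [conv_eq S K hS] at h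
    simpa [dotProduct, pow_two] using h
  have hA' := mul_eq_one_comm.mp hA
  set y : ZMod n → ZMod n → Fin cout → ℝ := fun a a' => H.transpose.mulVec (x a a') with hy
  have hconv : ∀ α α' : ZMod n, (∑ᶠ β : ℤ × ℤ, ((H * K β).transpose).mulVec
            (x (α - (β.1 : ZMod n)) (α' - (β.2 : ZMod n)))) =
      circConv2 (fun β => (K β).transpose) y α α' := by
    intro α α'
    simp only [circConv2, hy, Matrix.transpose_mul, Matrix.mulVec_mulVec]
  have hS' : ∀ β, (fun β => (K β).transpose) β ≠ 0 → β ∈ S := fun β h =>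
    hS β fun h0 => h (by simp [h0])
  simp only [hconv]
  let e : (ZMod n × ZMod n) × Fin cout ≃ (ZMod n × ZMod n) × Fin cout :=
    (Equiv.neg _).prodCongr (Equiv.refl _)
  have hB : circM (n := n) S (fun β => (K β).transpose) = (circM S K).transpose.submatrix e e := by
    ext p q
    have : -q.1 - -p.1 = p.1 - q.1 := by abel
    simp [circM, e, foldK, Matrix.sum_apply, this]
    refine Finset.sum_congr rfl fun β _ => ?_
    split_ifs <;> simp
  have hBB : (circM (n := n) S (fun β => (K β).transpose)).transpose *
      circM S (fun β => (K β).transpose) = 1 := by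
    rw [hB, Matrix.transpose_submatrix, Matrix.transpose_transpose,
      Matrix.submatrix_mul_equiv, hA', Matrix.submatrix_one_equiv]
  rw [sum_flat (fun α α' j => circConv2 (fun β => (K β).transpose) y α α' j ^ 2)]
  simp only [conv_eq S _ hS']
  have iso : ∀ {ι κ : Type} [Fintype ι] [Fintype κ] [DecidableEq κ] (B : Matrix ι κ ℝ)
      (_ : B.transpose * B = 1) (v : κ → ℝ), ∑ p, (B.mulVec v) p ^ 2 = ∑ q, v q ^ 2 := by
    intro ι κ _ _ _ B h v
    have : dotProduct (B.mulVec v) (B.mulVec v) = dotProduct v v := by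
      rw [Matrix.dotProduct_mulVec, ← Matrix.mulVec_transpose, Matrix.mulVec_mulVec, h,
        Matrix.one_mulVec]
    simpa [dotProduct, pow_two] using this
  rw [iso _ hBB, ← sum_flat (fun α α' j => y α α' j ^ 2)]
  refine Finset.sum_congr rfl fun α _ => Finset.sum_congr rfl fun α' _ => ?_
  exact iso H.transpose (by simpa using hH) (x α α')
end

section
/- Let c_in ≤ c_out, n, and 𝕜 be positive integers, and let H ∈ ℝ^{c_in×c_out} satisfy H Hᵀ = I_{c_in}. Fix a spatial offset (β₀, β₀') ∈ ℤ², and define the kernel K : ℤ² → ℝ^{c_in×c_out} by K(β₀,β₀') = H and K(β,β') = 0 for all (β,β') ≠ (β₀,β₀'). For x : (ℤ/nℤ)² → ℝ^{c_in}, define (K ∗ x)(α,α') = Σ_{β,β'} K(β,β')ᵀ x(α+β, α'+β') ∈ ℝ^{c_out} (indices mod n). Then Σ_{α,α'} ‖(K ∗ x)(α,α')‖₂² = Σ_{α,α'} ‖x(α,α')‖₂² for every x; i.e., the Delta kernel built from H is an orthogonal kernel. -/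
/-- Correctness of the Delta-Orthogonal initialization (Algorithm 2): the kernel that
places a matrix `H` with orthonormal rows (`H Hᵀ = I`) at a single spatial position
`(β₀, β₀')` and zero elsewhere defines a norm-preserving periodic convolution
`(K ∗ x)(α,α') = ∑_{β,β'} K(β,β')ᵀ x(α+β, α'+β')`. -/
theorem stmt19
    (cin cout n κ : ℕ) (hcc : cin ≤ cout) (hcin : 0 < cin) (hκ : 0 < κ) [NeZero n]
    (H : Matrix (Fin cin) (Fin cout) ℝ)
    (hH : H * H.transpose = 1)
    (β₀ β₀' : ℤ)
    (K : ℤ × ℤ → Matrix (Fin cin) (Fin cout) ℝ)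
    (hK : ∀ β : ℤ × ℤ, K β = if β = (β₀, β₀') then H else 0) :
    ∀ x : ZMod n → ZMod n → Fin cin → ℝ,
      ∑ α : ZMod n, ∑ α' : ZMod n, ∑ j : Fin cout,
          (∑ᶠ β : ℤ × ℤ, ((K β).transpose).mulVec
            (x (α + (β.1 : ZMod n)) (α' + (β.2 : ZMod n)))) j ^ 2 =
        ∑ α : ZMod n, ∑ α' : ZMod n, ∑ j : Fin cin, x α α' j ^ 2 := by
  intro x
  have hnorm : ∀ v : Fin cin → ℝ,
      ∑ j : Fin cout, (H.transpose.mulVec v) j ^ 2 = ∑ j : Fin cin, v j ^ 2 := by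
    intro v
    have h1 : (H.transpose.mulVec v) ⬝ᵥ (H.transpose.mulVec v) = v ⬝ᵥ v := by
      rw [Matrix.dotProduct_mulVec, Matrix.vecMul_transpose, Matrix.mulVec_mulVec, hH,
        Matrix.one_mulVec]
    simpa [dotProduct, sq] using h1
  have hconv : ∀ α α' : ZMod n,
      (∑ᶠ β : ℤ × ℤ, ((K β).transpose).mulVec
        (x (α + (β.1 : ZMod n)) (α' + (β.2 : ZMod n)))) =
      H.transpose.mulVec (x (α + (β₀ : ZMod n)) (α' + (β₀' : ZMod n))) := by
    intro α α'
    rw [finsum_eq_single _ (β₀, β₀')]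
    · simp [hK]
    · intro β hβ
      simp [hK, hβ]
  simp only [hconv, hnorm]
  refine (Equiv.sum_comp (Equiv.addRight (β₀ : ZMod n))
    (fun a => ∑ α' : ZMod n, ∑ j : Fin cin, x a (α' + (β₀' : ZMod n)) j ^ 2)).trans ?_
  refine Finset.sum_congr rfl fun α _ => ?_
  exact Equiv.sum_comp (Equiv.addRight (β₀' : ZMod n)) (fun a => ∑ j : Fin cin, x α a j ^ 2)
end
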